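/- As formal power series in t and z over the ring of formal power series in x_1, x_2, …, one has (Σ_{n,j≥0} Q̃_{n,j} t^j z^n) · (H(zt) − t·H(z)) = 1 − t, where H(z) = Σ_{n≥0} h_n z^n. Equivalently, for all n ≥ 1 and i ≥ 0, the coefficient of t^i in Σ_{m=0}^{n} Σ_{j≥0} Q̃_{m,j} h_{n−m} (t^{j+n−m} − t^{j+1}) is zero, and for n = 0 the double sum equals 1 − t. -/

import Mathlib

/-!
STATEMENT 7: As formal power series in t and z over the ring of formal power series in
x_1, x_2, …, one has (Σ_{n,j≥0} Q̃_{n,j} t^j z^n) · (H(zt) − t·H(z)) = 1 − t,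
where H(z) = Σ_{n≥0} h_n z^n.

We work in `MvPowerSeries (Fin 2) R` with `R = MvPowerSeries ℕ+ ℚ`, where variable `0`
is `t` and variable `1` is `z`.  A series such as `H(zt) = Σ_n h_n t^n z^n` is specified
by its (t,z)-coefficients.
-/

open scoped Classical

/-- The one-line value `σ(i)` of a permutation of `[n] = {1,…,n}` (1-based), extended
to all of `ℕ` by the identity outside `[n]`. -/
def pv {n : ℕ} (σ : Equiv.Perm (Fin n)) (i : ℕ) : ℕ :=
  if h : 1 ≤ i ∧ i ≤ n then ((σ ⟨i - 1, by omega⟩ : Fin n) : ℕ) + 1 else i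

/-- The excedance set `Exc(σ) = {i ∈ [n-1] : σ(i) > i}`. -/
def ExcSet {n : ℕ} (σ : Equiv.Perm (Fin n)) : Finset ℕ :=
  (Finset.Icc 1 (n - 1)).filter fun i => i < pv σ i

/-- The excedance number `exc(σ) = |Exc(σ)|`. -/
def exc {n : ℕ} (σ : Equiv.Perm (Fin n)) : ℕ := (ExcSet σ).card

/-- The excedance-descent set `Exd(σ) ⊆ [n-1]`: `i ∈ Exd(σ)` iff
(σ(i) ≤ i and σ(i+1) > i+1), or (σ(i) > i and σ(i+1) > i+1 and σ(i) > σ(i+1)),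
or (σ(i) ≤ i and σ(i+1) ≤ i+1 and σ(i) > σ(i+1)). -/
def ExdSet {n : ℕ} (σ : Equiv.Perm (Fin n)) : Finset ℕ :=
  (Finset.Icc 1 (n - 1)).filter fun i =>
    (pv σ i ≤ i ∧ i + 1 < pv σ (i + 1)) ∨
    (i < pv σ i ∧ i + 1 < pv σ (i + 1) ∧ pv σ (i + 1) < pv σ i) ∨
    (pv σ i ≤ i ∧ pv σ (i + 1) ≤ i + 1 ∧ pv σ (i + 1) < pv σ i)

/-- The ring of formal power series in countably many variables x_1, x_2, … over ℚ. -/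
abbrev R : Type := MvPowerSeries ℕ+ ℚ

/-- The fundamental quasisymmetric function `F_{S,n}(x_1,x_2,…)`: its coefficient on the
monomial with exponent vector `d` is the number of sequences of positive integers
`i_1 ≥ ⋯ ≥ i_n` with `i_j > i_{j+1}` for all `j ∈ S` whose associated monomial
`x_{i_1}⋯x_{i_n}` is `x^d` (the sequence is recorded as `f : Fin n → ℕ+`, with `f j` the
`(j+1)`-st entry `i_{j+1}`). -/
noncomputable def Fqs (n : ℕ) (S : Finset ℕ) : R := fun d =>
  (Nat.card {f : Fin n → ℕ+ //
    (∀ j : Fin n, ∀ hj : j.val + 1 < n,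
      f ⟨j.val + 1, hj⟩ ≤ f j ∧ (j.val + 1 ∈ S → f ⟨j.val + 1, hj⟩ < f j)) ∧
    ∀ i : ℕ+, d i = (Finset.univ.filter fun j => f j = i).card} : ℚ)

/-- `Q_{n,j} = Σ F_{Exd(σ),n}` over permutations `σ ∈ S_n` with `exc(σ) = j`. -/
noncomputable def Qsym (n j : ℕ) : R :=
  ∑ σ ∈ Finset.univ.filter (fun σ : Equiv.Perm (Fin n) => exc σ = j), Fqs n (ExdSet σ)

/-- The complete homogeneous symmetric function `h_n`: every monomial of total degree
`n` has coefficient `1`. -/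
noncomputable def hSym (n : ℕ) : R := fun d => if (d.sum fun _ e => e) = n then 1 else 0

/-- `Q̃_{n,j} = Σ F_{Exd(σ),n}` over derangements `σ ∈ S_n` (permutations with no fixed
point) with `exc(σ) = j`.  (For `n = 0` this gives `Q̃_{0,0} = 1`, and `Q̃_{n,j} = 0`
whenever there is no such derangement.) -/
noncomputable def Qtilde (n j : ℕ) : R :=
  ∑ σ ∈ Finset.univ.filter
      (fun σ : Equiv.Perm (Fin n) => (∀ i, σ i ≠ i) ∧ exc σ = j),
    Fqs n (ExdSet σ)

/-- The generating function `Σ_{n,j≥0} Q̃_{n,j} t^j z^n` (coefficient of `t^j z^n`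
is `Q̃_{n,j}`); variable `0` is `t`, variable `1` is `z`. -/
noncomputable def genQtilde : MvPowerSeries (Fin 2) R := fun d => Qtilde (d 1) (d 0)

/-- `H(zt) = Σ_{n≥0} h_n t^n z^n`. -/
noncomputable def Hzt : MvPowerSeries (Fin 2) R := fun d =>
  if d 0 = d 1 then hSym (d 1) else 0

/-- `H(z) = Σ_{n≥0} h_n z^n`. -/
noncomputable def Hz : MvPowerSeries (Fin 2) R := fun d =>
  if d 0 = 0 then hSym (d 1) else 0

/-- The variable `t`. -/
noncomputable def T : MvPowerSeries (Fin 2) R := MvPowerSeries.X 0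


/-- Splitting a product over a chain at successive thresholds. -/
theorem sum_mul_prod_threshold_eq {A : Type*} [CommRing A] {ι : Type*} [LinearOrder ι]
    (t : A) (y : ι → A) (s : Finset ι) (c : A) :
    (c + ∑ l ∈ s, y l) *
        ∏ k ∈ s, (c + ∑ l ∈ s, (if l < k then y l else t * y l)) =
      (c + t * ∑ l ∈ s, y l) *
        ∏ k ∈ s, (c + ∑ l ∈ s, (if l ≤ k then y l else t * y l)) := by
  induction s using Finset.induction_on_max generalizing c with
  | empty => simp
  | insert m s hm ih =>
    have hms : m ∉ s := fun h => lt_irrefl _ (hm m h)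
    have h1 : ∀ k ∈ s, (c + ∑ l ∈ insert m s, (if l < k then y l else t * y l)) =
        (c + t * y m) + ∑ l ∈ s, (if l < k then y l else t * y l) := by
      intro k hk
      rw [Finset.sum_insert hms, if_neg (hm k hk).not_gt]; ring
    have h2 : ∀ k ∈ s, (c + ∑ l ∈ insert m s, (if l ≤ k then y l else t * y l)) =
        (c + t * y m) + ∑ l ∈ s, (if l ≤ k then y l else t * y l) := by
      intro k hk
      rw [Finset.sum_insert hms, if_neg (hm k hk).not_ge]; ring
    have h3 : ∑ l ∈ s, (if l < m then y l else t * y l) = ∑ l ∈ s, y l :=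
      Finset.sum_congr rfl fun l hl => if_pos (hm l hl)
    have h4 : ∑ l ∈ s, (if l ≤ m then y l else t * y l) = ∑ l ∈ s, y l :=
      Finset.sum_congr rfl fun l hl => if_pos (hm l hl).le
    rw [Finset.prod_insert hms, Finset.prod_insert hms, Finset.prod_congr rfl h1,
      Finset.prod_congr rfl h2]
    simp only [Finset.sum_insert hms, lt_irrefl, le_refl, if_true, if_false, h3, h4]
    linear_combination (c + y m + ∑ l ∈ s, y l) * ih (c + t * y m)

/-- The weight of a block of `m` positions: `a` is the total weight of the letters different from
the letter `y` of the block, and `t` marks excedances. -/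
noncomputable def blockWeight {A : Type*} [CommRing A] (t a y : A) : ℕ → A
  | 0 => 1
  | 1 => a
  | m + 2 => (a + y) * (a + t * y) * (a + (1 + t) * y) ^ m

theorem sum_blockWeight_mul_pow {A : Type*} [CommRing A] (t a y : A) (m : ℕ) :
    ∑ p ∈ Finset.HasAntidiagonal.antidiagonal (m + 1), blockWeight t a y p.1 * y ^ p.2 =
      (a + y) * (a + (1 + t) * y) ^ m := by
  induction m with
  | zero => simp [Finset.Nat.antidiagonal_succ, blockWeight]; ring
  | succ m ih =>
    rw [Finset.Nat.sum_antidiagonal_succ']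
    simp only [pow_succ y]
    simp only [← mul_assoc, ← Finset.sum_mul]
    rw [ih, blockWeight]
    ring

theorem sum_blockWeight_mul_mul_pow {A : Type*} [CommRing A] (t a y : A) (m : ℕ) :
    ∑ p ∈ Finset.HasAntidiagonal.antidiagonal (m + 1), blockWeight t a y p.1 * (t * y) ^ p.2 =
      (a + t * y) * (a + (1 + t) * y) ^ m := by
  induction m with
  | zero => simp [Finset.Nat.antidiagonal_succ, blockWeight]; ring
  | succ m ih =>
    rw [Finset.Nat.sum_antidiagonal_succ']
    simp only [pow_succ (t * y)]
    simp only [← mul_assoc _ _ (t * y), ← Finset.sum_mul]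
    rw [ih, blockWeight]
    ring

/-- The total weight of the letters of `s` different from `k`. -/
noncomputable def offWeight {A : Type*} [CommRing A] {ι : Type*} [LinearOrder ι]
    (t : A) (y : ι → A) (s : Finset ι) (k : ι) : A :=
  ∑ l ∈ s, (if k < l then t * y l else if l < k then y l else 0)

theorem offWeight_add {A : Type*} [CommRing A] {ι : Type*} [LinearOrder ι]
    (t : A) (y : ι → A) (s : Finset ι) {k : ι} (hk : k ∈ s) :
    offWeight t y s k + y k = ∑ l ∈ s, (if l ≤ k then y l else t * y l) := by
  have : y k = ∑ l ∈ s, if l = k then y l else 0 := by simp [hk]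
  rw [this, offWeight, ← Finset.sum_add_distrib]
  refine Finset.sum_congr rfl fun l _ => ?_
  rcases lt_trichotomy l k with h | h | h
  · simp [h, h.le, h.ne, h.not_gt]
  · simp [h]
  · simp [h, h.ne', h.not_ge]

theorem offWeight_add_mul {A : Type*} [CommRing A] {ι : Type*} [LinearOrder ι]
    (t : A) (y : ι → A) (s : Finset ι) {k : ι} (hk : k ∈ s) :
    offWeight t y s k + t * y k = ∑ l ∈ s, (if l < k then y l else t * y l) := by
  have : t * y k = ∑ l ∈ s, if l = k then t * y l else 0 := by simp [hk]
  rw [this, offWeight, ← Finset.sum_add_distrib]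
  refine Finset.sum_congr rfl fun l _ => ?_
  rcases lt_trichotomy l k with h | h | h
  · simp [h, h.ne, h.not_gt]
  · simp [h]
  · simp [h, h.ne', h.not_gt]

theorem prod_sum_blockWeight_eq {A : Type*} [CommRing A] [IsDomain A] {ι : Type*} [LinearOrder ι]
    (t : A) (y : ι → A) (d : ι →₀ ℕ) (hy : ∑ l ∈ d.support, y l ≠ 0) :
    ∏ k ∈ d.support, ∑ p ∈ Finset.HasAntidiagonal.antidiagonal (d k),
        blockWeight t (offWeight t y d.support k) (y k) p.1 * (t * y k) ^ p.2 =
      t * ∏ k ∈ d.support, ∑ p ∈ Finset.HasAntidiagonal.antidiagonal (d k),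
        blockWeight t (offWeight t y d.support k) (y k) p.1 * y k ^ p.2 := by
  have key := sum_mul_prod_threshold_eq t y d.support 0
  simp only [zero_add] at key
  have key' := mul_left_cancel₀ hy (key.trans (by ring :
    _ = (∑ l ∈ d.support, y l) * (t * ∏ k ∈ d.support,
      ∑ l ∈ d.support, (if l ≤ k then y l else t * y l))))
  have hd : ∀ k ∈ d.support, ∃ m, d k = m + 1 := fun k hk =>
    Nat.exists_eq_succ_of_ne_zero (Finsupp.mem_support_iff.1 hk)
  have e1 : ∀ k ∈ d.support, ∑ p ∈ Finset.HasAntidiagonal.antidiagonal (d k),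
        blockWeight t (offWeight t y d.support k) (y k) p.1 * (t * y k) ^ p.2 =
      (∑ l ∈ d.support, (if l < k then y l else t * y l)) *
        (offWeight t y d.support k + (1 + t) * y k) ^ (d k - 1) := by
    intro k hk
    obtain ⟨m, hm⟩ := hd k hk
    rw [hm, sum_blockWeight_mul_mul_pow, offWeight_add_mul t y _ hk, Nat.add_sub_cancel]
  have e2 : ∀ k ∈ d.support, ∑ p ∈ Finset.HasAntidiagonal.antidiagonal (d k),
        blockWeight t (offWeight t y d.support k) (y k) p.1 * y k ^ p.2 =
      (∑ l ∈ d.support, (if l ≤ k then y l else t * y l)) *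
        (offWeight t y d.support k + (1 + t) * y k) ^ (d k - 1) := by
    intro k hk
    obtain ⟨m, hm⟩ := hd k hk
    rw [hm, sum_blockWeight_mul_pow, offWeight_add t y _ hk, Nat.add_sub_cancel]
  rw [Finset.prod_congr rfl e1, Finset.prod_congr rfl e2, Finset.prod_mul_distrib,
    Finset.prod_mul_distrib, key', mul_assoc]

/-- Product of sums over antidiagonals, as a sum over the antidiagonal of a finitely supported
function. -/
theorem prod_sum_antidiagonal {A : Type*} [CommSemiring A] {ι : Type*} [DecidableEq ι]
    (d : ι →₀ ℕ) (F : ι → ℕ → ℕ → A) :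
    ∏ k ∈ d.support, ∑ p ∈ Finset.HasAntidiagonal.antidiagonal (d k), F k p.1 p.2 =
      ∑ q ∈ Finset.HasAntidiagonal.antidiagonal d, ∏ k ∈ d.support, F k (q.1 k) (q.2 k) := by
  rw [Finset.prod_sum]
  symm
  refine Finset.sum_bij' (fun q _ k _ => (q.1 k, q.2 k))
    (fun p _ => (Finsupp.indicator d.support fun k hk => (p k hk).1,
      Finsupp.indicator d.support fun k hk => (p k hk).2)) ?_ ?_ ?_ ?_ ?_
  · intro q hq
    simp only [Finset.mem_pi, Finset.HasAntidiagonal.mem_antidiagonal] at hq ⊢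
    intro k _
    rw [← hq]; rfl
  · intro p hp
    simp only [Finset.mem_pi, Finset.HasAntidiagonal.mem_antidiagonal] at hp ⊢
    ext k
    by_cases hk : k ∈ d.support
    · simp [Finsupp.indicator_of_mem hk, hp k hk]
    · simp [Finsupp.indicator_of_notMem hk, Finsupp.notMem_support_iff.1 hk]
  · intro q hq
    simp only [Finset.HasAntidiagonal.mem_antidiagonal] at hq
    ext k
    · by_cases hk : k ∈ d.support
      · simp [Finsupp.indicator_of_mem hk]
      · have : q.1 k + q.2 k = 0 := by
          rw [← Finsupp.add_apply, hq, Finsupp.notMem_support_iff.1 hk]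
        simp [Finsupp.indicator_of_notMem hk]; omega
    · by_cases hk : k ∈ d.support
      · simp [Finsupp.indicator_of_mem hk]
      · have : q.1 k + q.2 k = 0 := by
          rw [← Finsupp.add_apply, hq, Finsupp.notMem_support_iff.1 hk]
        simp [Finsupp.indicator_of_notMem hk]; omega
  · intro p hp
    funext k hk
    simp [Finsupp.indicator_of_mem hk]
  · intro q hq
    exact (Finset.prod_attach d.support fun k => F k (q.1 k) (q.2 k)).symm

theorem prod_block_eq_blockWeight {A ι : Type*} [CommRing A] [LinearOrder ι] (t a y : A)
    (S : Finset ι) :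
    ∏ v ∈ S, (a + (if ∃ w ∈ S, w < v then t * y else 0) + (if ∃ w ∈ S, v < w then y else 0)) =
      blockWeight t a y S.card := by
  rcases S.card.eq_zero_or_pos with h0 | hpos
  · rw [h0, Finset.card_eq_zero.1 h0]; simp [blockWeight]
  have hne : S.Nonempty := Finset.card_pos.1 hpos
  rcases Nat.lt_or_ge 1 S.card with h2 | h1
  · have hlt : S.min' hne < S.max' hne := Finset.min'_lt_max'_of_card S h2
    have hmin := S.min'_mem hne
    have hmax := S.max'_mem hne
    have hmax' : S.max' hne ∈ S.erase (S.min' hne) := Finset.mem_erase.2 ⟨hlt.ne', hmax⟩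
    rw [← Finset.mul_prod_erase S _ hmin, ← Finset.mul_prod_erase _ _ hmax',
      if_neg (fun ⟨w, hw, hw'⟩ => (S.min'_le w hw).not_gt hw'), if_pos ⟨_, hmax, hlt⟩,
      if_pos ⟨_, hmin, hlt⟩, if_neg (fun ⟨w, hw, hw'⟩ => (S.le_max' w hw).not_gt hw')]
    have hrest : ∀ v ∈ (S.erase (S.min' hne)).erase (S.max' hne),
        (a + (if ∃ w ∈ S, w < v then t * y else 0) + (if ∃ w ∈ S, v < w then y else 0)) =
          a + (1 + t) * y := by
      intro v hv
      simp only [Finset.mem_erase] at hv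
      rw [if_pos ⟨_, hmin, lt_of_le_of_ne (S.min'_le v hv.2.2) (Ne.symm hv.2.1)⟩,
        if_pos ⟨_, hmax, lt_of_le_of_ne (S.le_max' v hv.2.2) hv.1⟩]
      ring
    obtain ⟨m, hm⟩ := Nat.exists_eq_add_of_le' h2
    rw [Finset.prod_congr rfl hrest, Finset.prod_const, Finset.card_erase_of_mem hmax',
      Finset.card_erase_of_mem hmin, hm, blockWeight, Nat.succ_eq_add_one]
    simp only [show m + (1 + 1) - 1 - 1 = m by omega]
    ring
  · obtain ⟨v, rfl⟩ := Finset.card_eq_one.1 (le_antisymm h1 hpos)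
    simp [blockWeight]

/-- `g` takes each value `i` exactly `d i` times. -/
def HasContent {n : ℕ} (g : Fin n → ℕ+) (d : ℕ+ →₀ ℕ) : Prop :=
  ∀ i, d i = (Finset.univ.filter fun j => g j = i).card

/-- The letters from `s` allowed at the place `v` over the letter `f v`, flagged `false` for an
excedance and `true` for a drop. -/
noncomputable def flaggedLetters {n : ℕ} (f : Fin n → ℕ+) (s : Finset ℕ+) (v : Fin n) :
    Finset (Bool × ℕ+) :=
  (Finset.univ ×ˢ s).filter fun p =>
    if p.1 then p.2 < f v ∨ (p.2 = f v ∧ ∃ w, v < w ∧ f w = f v)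
    else f v < p.2 ∨ (p.2 = f v ∧ ∃ w, w < v ∧ f w = f v)

/-- The weight of a flagged letter. -/
noncomputable def letterWeight (p : Bool × ℕ+) : MvPolynomial ℕ+ (Polynomial ℚ) :=
  MvPolynomial.monomial (Finsupp.single p.2 1) (if p.1 then 1 else Polynomial.X)

theorem sum_letterWeight {n : ℕ} (f : Fin n → ℕ+) (s : Finset ℕ+) (v : Fin n) (hv : f v ∈ s) :
    ∑ p ∈ flaggedLetters f s v, letterWeight p =
      offWeight (MvPolynomial.C Polynomial.X) MvPolynomial.X s (f v)
        + (if ∃ w, w < v ∧ f w = f v then MvPolynomial.C Polynomial.X * MvPolynomial.X (f v) else 0)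
        + (if ∃ w, v < w ∧ f w = f v then MvPolynomial.X (f v) else 0) := by
  have h0 : ∀ l, letterWeight (false, l) = MvPolynomial.C Polynomial.X * MvPolynomial.X l := by
    intro l; simp [letterWeight, MvPolynomial.C_mul_X_eq_monomial]
  have h1 : ∀ l, letterWeight (true, l) = MvPolynomial.X l := by
    intro l; simp [letterWeight, MvPolynomial.X]
  have e1 : ∀ z : MvPolynomial ℕ+ (Polynomial ℚ), z = ∑ l ∈ s, if l = f v then z else 0 := by
    intro z; simp [hv]
  rw [flaggedLetters, Finset.sum_filter, Finset.sum_product, Fintype.sum_bool]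
  simp only [h0, h1, if_true, Bool.false_eq_true, if_false]
  rw [offWeight, e1 (if ∃ w, w < v ∧ f w = f v then MvPolynomial.C Polynomial.X * MvPolynomial.X (f v) else 0),
    e1 (if ∃ w, v < w ∧ f w = f v then MvPolynomial.X (f v) else 0), ← Finset.sum_add_distrib,
    ← Finset.sum_add_distrib, ← Finset.sum_add_distrib]
  refine Finset.sum_congr rfl fun l _ => ?_
  rcases lt_trichotomy l (f v) with h | h | h
  · simp [h, h.ne, h.not_gt]
  · subst h; simp [add_comm]
  · simp [h, h.ne', h.not_gt]

theorem prod_sum_letterWeight {n : ℕ} (f : Fin n → ℕ+) (d : ℕ+ →₀ ℕ) (hf : HasContent f d)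
    (s : Finset ℕ+) (hs : d.support ⊆ s) :
    ∏ v, ∑ p ∈ flaggedLetters f s v, letterWeight p =
      ∏ k ∈ s, blockWeight (MvPolynomial.C Polynomial.X)
        (offWeight (MvPolynomial.C Polynomial.X) MvPolynomial.X s k) (MvPolynomial.X k) (d k) := by
  have hfs : ∀ v, f v ∈ s := fun v => hs <| Finsupp.mem_support_iff.2 <| by
    rw [hf]; exact (Finset.card_pos.2 ⟨v, by simp⟩).ne'
  rw [← Finset.prod_fiberwise_of_maps_to (s := Finset.univ) (t := s) (g := f) fun v _ => hfs v]
  refine Finset.prod_congr rfl fun k _ => ?_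
  rw [hf k, ← prod_block_eq_blockWeight]
  refine Finset.prod_congr rfl fun v hv => ?_
  obtain rfl : f v = k := by simpa using hv
  rw [sum_letterWeight f s v (hfs v)]
  simp [and_comm]

/-- The flagged words over `f` with the content `d` and `j` excedance flags. -/
noncomputable def flaggedWords {n : ℕ} (f : Fin n → ℕ+) (d : ℕ+ →₀ ℕ) (s : Finset ℕ+) (j : ℕ) :
    Finset (Fin n → Bool × ℕ+) :=
  (Fintype.piFinset (flaggedLetters f s)).filter fun u =>
    HasContent (fun v => (u v).2) d ∧ (Finset.univ.filter fun v => (u v).1 = false).card = j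

theorem hasContent_iff_sum_single {n : ℕ} (g : Fin n → ℕ+) (d : ℕ+ →₀ ℕ) :
    HasContent g d ↔ ∑ v, Finsupp.single (g v) 1 = d := by
  rw [HasContent, DFunLike.ext_iff]
  refine forall_congr' fun i => ?_
  rw [Finsupp.finsetSum_apply, Finset.card_filter, eq_comm]
  simp [Finsupp.single_apply]

theorem coeff_prod_sum_letterWeight {n : ℕ} (f : Fin n → ℕ+) (d : ℕ+ →₀ ℕ)
    (s : Finset ℕ+) (j : ℕ) :
    (MvPolynomial.coeff d (∏ v, ∑ p ∈ flaggedLetters f s v, letterWeight p)).coeff j =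
      ((flaggedWords f d s j).card : ℚ) := by
  rw [Finset.prod_univ_sum, MvPolynomial.coeff_sum, Polynomial.finsetSum_coeff, flaggedWords,
    Finset.card_filter, Nat.cast_sum]
  refine Finset.sum_congr rfl fun u _ => ?_
  simp only [letterWeight]
  have hmon : ∏ v, MvPolynomial.monomial (Finsupp.single (u v).2 1)
        (if (u v).1 = true then (1 : Polynomial ℚ) else Polynomial.X) =
      MvPolynomial.monomial (∑ v, Finsupp.single (u v).2 1)
        (Polynomial.X ^ (Finset.univ.filter fun v => (u v).1 = false).card) := by
    rw [← MvPolynomial.monomial_sum_prod, ← Finset.prod_const, Finset.prod_filter]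
    congr 1
    exact Finset.prod_congr rfl fun v _ => by cases (u v).1 <;> simp
  rw [hmon, MvPolynomial.coeff_monomial, hasContent_iff_sum_single]
  split_ifs with h1 h2 h2
  · simp [Polynomial.coeff_X_pow, h2.2]
  · have : ¬ j = _ := fun h => h2 ⟨h1, h.symm⟩
    simp [Polynomial.coeff_X_pow, this]
  · exact absurd h2.1 h1
  · simp

theorem pv_val_add_one {n : ℕ} (σ : Equiv.Perm (Fin n)) (i : Fin n) :
    pv σ (i.val + 1) = (σ i).val + 1 := by
  have := i.isLt
  simp [pv]

theorem exc_eq_card {n : ℕ} (σ : Equiv.Perm (Fin n)) :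
    exc σ = (Finset.univ.filter fun i => i < σ i).card := by
  symm
  refine Finset.card_bij (fun i _ => i.val + 1) ?_ ?_ ?_
  · intro i hi
    have h : i < σ i := by simpa using hi
    have h2 := (σ i).isLt
    rw [Fin.lt_def] at h
    simp only [ExcSet, Finset.mem_filter, Finset.mem_Icc, pv_val_add_one]
    omega
  · intro i _ j _ h
    exact Fin.ext (by simpa using h)
  · intro b hb
    simp only [ExcSet, Finset.mem_filter, Finset.mem_Icc] at hb
    obtain ⟨⟨h1, h2⟩, h3⟩ := hb
    refine ⟨⟨b - 1, by omega⟩, ?_, by simp; omega⟩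
    have := pv_val_add_one σ ⟨b - 1, by omega⟩
    simp only [Nat.sub_add_cancel h1] at this
    simp only [Finset.mem_filter, Finset.mem_univ, true_and, Fin.lt_def]
    omega

theorem val_add_one_mem_ExdSet {n : ℕ} (σ : Equiv.Perm (Fin n)) (i : Fin n)
    (hi : i.val + 1 < n) :
    i.val + 1 ∈ ExdSet σ ↔
      (σ i ≤ i ∧ (⟨i.val + 1, hi⟩ : Fin n) < σ ⟨i.val + 1, hi⟩) ∨
      (i < σ i ∧ (⟨i.val + 1, hi⟩ : Fin n) < σ ⟨i.val + 1, hi⟩ ∧ σ ⟨i.val + 1, hi⟩ < σ i) ∨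
      (σ i ≤ i ∧ σ ⟨i.val + 1, hi⟩ ≤ ⟨i.val + 1, hi⟩ ∧ σ ⟨i.val + 1, hi⟩ < σ i) := by
  have h := pv_val_add_one σ ⟨i.val + 1, hi⟩
  simp only at h
  simp only [ExdSet, Finset.mem_filter, Finset.mem_Icc, pv_val_add_one, h, Fin.lt_def, Fin.le_def]
  omega

/-- `f` is weakly decreasing, and strictly so at the places in `S`. -/
def IsCompatible {n : ℕ} (S : Finset ℕ) (f : Fin n → ℕ+) : Prop :=
  ∀ j : Fin n, ∀ hj : j.val + 1 < n,
    f ⟨j.val + 1, hj⟩ ≤ f j ∧ (j.val + 1 ∈ S → f ⟨j.val + 1, hj⟩ < f j)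

theorem IsCompatible.antitone {n : ℕ} {S : Finset ℕ} {f : Fin n → ℕ+} (h : IsCompatible S f) :
    Antitone f := by
  cases n with
  | zero => exact fun i => i.elim0
  | succ n => exact Fin.antitone_iff_succ_le.2 fun i => (h i.castSucc (by simp)).1

theorem exists_perm_of_hasContent {n : ℕ} {f g : Fin n → ℕ+} {d : ℕ+ →₀ ℕ}
    (hf : HasContent f d) (hg : HasContent g d) : ∃ τ : Equiv.Perm (Fin n), f = g ∘ τ := by
  have h : ∀ c, Nonempty ({a // f a = c} ≃ {b // g b = c}) := fun c => by
    refine ⟨Fintype.equivOfCardEq ?_⟩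
    rw [Fintype.card_subtype, Fintype.card_subtype, ← hf c, ← hg c]
  exact ⟨Equiv.ofFiberEquiv fun c => (h c).some,
    funext fun a => (Equiv.ofFiberEquiv_map (fun c => (h c).some) a).symm⟩

theorem HasContent.comp_perm {n : ℕ} {f : Fin n → ℕ+} {d : ℕ+ →₀ ℕ} (hf : HasContent f d)
    (τ : Equiv.Perm (Fin n)) : HasContent (f ∘ τ) d := by
  rw [hasContent_iff_sum_single] at hf ⊢
  rw [← hf]
  exact Equiv.sum_comp τ fun v => Finsupp.single (f v) 1

theorem Antitone.eq_of_hasContent {n : ℕ} {f g : Fin n → ℕ+} {d : ℕ+ →₀ ℕ}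
    (hf : Antitone f) (hg : Antitone g) (hfd : HasContent f d) (hgd : HasContent g d) : f = g := by
  obtain ⟨τ, rfl⟩ := exists_perm_of_hasContent hfd hgd
  have := Tuple.unique_monotone (f := OrderDual.toDual ∘ g) (σ := τ) (τ := Equiv.refl _)
    (fun i j h => hf h) (fun i j h => hg h)
  funext i
  exact congrArg OrderDual.ofDual (congrFun this i)

theorem exists_antitone_hasContent (d : ℕ+ →₀ ℕ) :
    ∃ f : Fin (d.sum fun _ e => e) → ℕ+, Antitone f ∧ HasContent f d := by
  have hcard : d.toMultiset.toList.length = d.sum fun _ e => e := by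
    rw [Multiset.length_toList, Finsupp.card_toMultiset]; rfl
  let g : Fin (d.sum fun _ e => e) → ℕ+ := fun i => d.toMultiset.toList.get (i.cast hcard.symm)
  have hg : HasContent g d := by
    rw [hasContent_iff_sum_single]
    have h1 : ∑ v, Finsupp.single (g v) 1 =
        ∑ v : Fin d.toMultiset.toList.length, Finsupp.single (d.toMultiset.toList.get v) 1 :=
      Equiv.sum_comp (finCongr hcard.symm)
        fun v => Finsupp.single (d.toMultiset.toList.get v) 1
    rw [h1, ← List.sum_ofFn]
    refine Function.LeftInverse.injective Finsupp.toMultiset_toFinsupp ?_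
    have h2 : List.ofFn (fun v => Finsupp.single (d.toMultiset.toList.get v) 1) =
        d.toMultiset.toList.map fun a => Finsupp.single a 1 := by
      conv_rhs => rw [← List.ofFn_get d.toMultiset.toList]
      rw [List.map_ofFn]; rfl
    rw [h2, map_list_sum, List.map_map, ← Multiset.sum_coe, ← Multiset.map_coe,
      Multiset.coe_toList]
    simp
  refine ⟨g ∘ Tuple.sort (OrderDual.toDual ∘ g), ?_, hg.comp_perm _⟩
  intro i j h
  exact Tuple.monotone_sort (OrderDual.toDual ∘ g) h

theorem coeff_Fqs {n : ℕ} {f : Fin n → ℕ+} {d : ℕ+ →₀ ℕ} (hf : Antitone f) (hfd : HasContent f d)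
    (S : Finset ℕ) : MvPowerSeries.coeff d (Fqs n S) = if IsCompatible S f then 1 else 0 := by
  change (Nat.card {g : Fin n → ℕ+ // IsCompatible S g ∧ HasContent g d} : ℚ) = _
  split_ifs with h
  · have : Unique {g : Fin n → ℕ+ // IsCompatible S g ∧ HasContent g d} :=
      { default := ⟨f, h, hfd⟩
        uniq := fun g => Subtype.ext (g.2.1.antitone.eq_of_hasContent hf g.2.2 hfd) }
    simp
  · have : IsEmpty {g : Fin n → ℕ+ // IsCompatible S g ∧ HasContent g d} :=
      ⟨fun g => h (g.2.1.antitone.eq_of_hasContent hf g.2.2 hfd ▸ g.2.1)⟩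
    simp

/-- The order in which a permutation lists the places of a flagged word. -/
def sortKey {n : ℕ} (u : Fin n → Bool × ℕ+) (v : Fin n) : ℕ+ᵒᵈ ×ₗ Bool :=
  toLex (OrderDual.toDual (u v).2, (u v).1)

/-- The flagged word of a permutation over `f`. -/
def flaggedWordOf {n : ℕ} (f : Fin n → ℕ+) (σ : Equiv.Perm (Fin n)) (v : Fin n) : Bool × ℕ+ :=
  (decide (v < σ.symm v), f (σ.symm v))

theorem flaggedWordOf_mem {n : ℕ} {f : Fin n → ℕ+} {d : ℕ+ →₀ ℕ} (hf : Antitone f)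
    (hfd : HasContent f d) {s : Finset ℕ+} (hs : d.support ⊆ s) {σ : Equiv.Perm (Fin n)}
    (hσ : ∀ i, σ i ≠ i) : flaggedWordOf f σ ∈ flaggedWords f d s (exc σ) := by
  have hne : ∀ v, σ.symm v ≠ v := fun v h => hσ v (σ.symm_apply_eq.1 h).symm
  rw [flaggedWords, Finset.mem_filter, Fintype.mem_piFinset]
  refine ⟨fun v => ?_, hfd.comp_perm σ.symm, ?_⟩
  · rw [flaggedLetters, Finset.mem_filter, Finset.mem_product]
    refine ⟨⟨Finset.mem_univ _, hs (Finsupp.mem_support_iff.2 ?_)⟩, ?_⟩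
    · rw [hfd]
      refine (Finset.card_pos.2 ⟨σ.symm v, ?_⟩).ne'
      exact Finset.mem_filter.2 ⟨Finset.mem_univ _, rfl⟩
    · simp only [flaggedWordOf, decide_eq_true_eq]
      split_ifs with h
      · rcases (hf h.le).lt_or_eq with h' | h'
        · exact Or.inl h'
        · exact Or.inr ⟨h', _, h, h'⟩
      · have h1 := lt_of_le_of_ne (not_lt.1 h) (hne v)
        rcases (hf h1.le).lt_or_eq with h' | h'
        · exact Or.inl h'
        · exact Or.inr ⟨h'.symm, _, h1, h'.symm⟩
  · rw [exc_eq_card]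
    refine Finset.card_equiv σ.symm fun v => ?_
    simp only [flaggedWordOf, decide_eq_false_iff_not, Finset.mem_filter, Finset.mem_univ,
      true_and, Equiv.apply_symm_apply, not_lt]
    exact ⟨fun h => lt_of_le_of_ne h (hne v), le_of_lt⟩

theorem eq_sort_flaggedWordOf {n : ℕ} {f : Fin n → ℕ+} {σ : Equiv.Perm (Fin n)}
    (hσ : ∀ i, σ i ≠ i) (hf : IsCompatible (ExdSet σ) f) :
    σ = Tuple.sort (sortKey (flaggedWordOf f σ)) := by
  have hmono : StrictMono fun i : Fin n =>
      (toLex (OrderDual.toDual (f i), toLex (decide (σ i < i), σ i)) :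
        ℕ+ᵒᵈ ×ₗ Bool ×ₗ Fin n) := by
    cases n with
    | zero => exact fun i => i.elim0
    | succ n =>
      refine Fin.strictMono_iff_lt_succ.2 fun i => ?_
      obtain ⟨h1, h2⟩ := hf i.castSucc (by simp)
      rw [val_add_one_mem_ExdSet σ i.castSucc (by simp)] at h2
      have e : (⟨i.castSucc.val + 1, by simp⟩ : Fin (n + 1)) = i.succ := rfl
      rw [e] at h1 h2
      have hi := hσ i.castSucc
      have hi' := hσ i.succ
      have hinj : σ i.castSucc ≠ σ i.succ := fun h => (Fin.castSucc_lt_succ (i := i)).ne (σ.injective h)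
      rw [Prod.Lex.toLex_lt_toLex]
      rcases h1.lt_or_eq with h | h
      · exact Or.inl h
      · refine Or.inr ⟨congrArg OrderDual.toDual h.symm, ?_⟩
        have h3 := mt h2 h.not_lt
        clear h2
        rw [Prod.Lex.toLex_lt_toLex]
        by_cases ha : σ i.castSucc < i.castSucc <;> by_cases hb : σ i.succ < i.succ
        · right; simp only [ha, hb]; grind
        · grind
        · left; simp [ha, hb]
        · right; simp only [ha, hb]; grind
  rw [Tuple.eq_sort_iff]
  have key : ∀ i, sortKey (flaggedWordOf f σ) (σ i) =
      toLex (OrderDual.toDual (f i), decide (σ i < i)) := by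
    intro i; simp [sortKey, flaggedWordOf]
  constructor
  · intro i j hij
    simp only [Function.comp, key]
    rcases hij.lt_or_eq with h | rfl
    · have := hmono h
      simp only [Prod.Lex.toLex_lt_toLex] at this
      rw [Prod.Lex.toLex_le_toLex]
      rcases this with h | ⟨h, h' | ⟨h', _⟩⟩
      · exact Or.inl h
      · exact Or.inr ⟨h, h'.le⟩
      · exact Or.inr ⟨h, h'.le⟩
    · exact le_rfl
  · intro i j hij h
    have := hmono hij
    simp only [key, toLex_inj, Prod.mk.injEq] at h
    simp only [Prod.Lex.toLex_lt_toLex, h.1, h.2, lt_irrefl, false_or, true_and] at this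
    exact this

section FlaggedWord

variable {n : ℕ} {f : Fin n → ℕ+} {d : ℕ+ →₀ ℕ} {s : Finset ℕ+} {j : ℕ}
  {u : Fin n → Bool × ℕ+}

theorem snd_sort_sortKey (hf : Antitone f) (hfd : HasContent f d) (hu : u ∈ flaggedWords f d s j)
    (i : Fin n) : (u (Tuple.sort (sortKey u) i)).2 = f i := by
  rw [flaggedWords, Finset.mem_filter] at hu
  refine congrFun (Antitone.eq_of_hasContent (d := d) (fun a b h => ?_) hf
    (hu.2.1.comp_perm (Tuple.sort (sortKey u))) hfd) i
  have := Prod.Lex.toLex_le_toLex.1 (Tuple.monotone_sort (sortKey u) h)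
  rcases this with h | h
  · exact h.le
  · exact (congrArg OrderDual.ofDual h.1).ge

theorem sort_sortKey_lt_or (hf : Antitone f) (hfd : HasContent f d)
    (hu : u ∈ flaggedWords f d s j) {i k : Fin n} (hik : i < k) (hfik : f i = f k) :
    (u (Tuple.sort (sortKey u) i)).1 < (u (Tuple.sort (sortKey u) k)).1 ∨
      (u (Tuple.sort (sortKey u) i)).1 = (u (Tuple.sort (sortKey u) k)).1 ∧
        Tuple.sort (sortKey u) i < Tuple.sort (sortKey u) k := by
  have h1 := Tuple.monotone_sort (sortKey u) hik.le
  have h2 := (Tuple.eq_sort_iff.1 (rfl : Tuple.sort (sortKey u) = _)).2 i k hik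
  have hi := snd_sort_sortKey hf hfd hu i
  have hk := snd_sort_sortKey hf hfd hu k
  simp only [Function.comp, sortKey, Prod.Lex.toLex_le_toLex, hi, hk, hfik, lt_irrefl, false_or,
    true_and, toLex_inj, Prod.mk.injEq] at h1 h2
  rcases h1.lt_or_eq with h | h
  · exact Or.inl h
  · exact Or.inr ⟨h, h2 h⟩

theorem lt_sort_sortKey (hf : Antitone f) (hfd : HasContent f d)
    (hu : u ∈ flaggedWords f d s j) (i : Fin n)
    (hi : (u (Tuple.sort (sortKey u) i)).1 = false) : i < Tuple.sort (sortKey u) i := by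
  induction hm : i.val using Nat.strong_induction_on generalizing i with
  | _ m ih =>
    have hfi := snd_sort_sortKey hf hfd hu i
    have hadm := Fintype.mem_piFinset.1 (Finset.mem_filter.1 hu).1 (Tuple.sort (sortKey u) i)
    simp only [flaggedLetters, Finset.mem_filter, hi, hfi, Bool.false_eq_true, if_false] at hadm
    by_contra hlt
    rw [not_lt] at hlt
    rcases hadm.2 with h | ⟨h, w, hw, hfw⟩
    · exact (hf hlt).not_gt h
    · have hw' := hw.trans_le hlt
      have hpos : i.val ≠ 0 := by rw [Fin.lt_def] at hw'; omega
      obtain ⟨i', hi'v⟩ : ∃ i' : Fin n, i'.val = i.val - 1 := ⟨⟨i.val - 1, by omega⟩, rfl⟩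
      have hi' : i' < i := by rw [Fin.lt_def]; omega
      have hwi' : w ≤ i' := by rw [Fin.le_def]; rw [Fin.lt_def] at hw'; omega
      have hfi' : f i' = f i :=
        le_antisymm ((hf hwi').trans (hfw.trans h.symm).le) (hf hi'.le)
      rcases sort_sortKey_lt_or hf hfd hu hi' hfi' with h1 | ⟨h1, h2⟩
      · rw [hi] at h1; exact absurd h1 (by simp)
      · have h3 := ih i'.val (by rw [← hm]; exact hi') i' (h1.trans hi) rfl
        rw [Fin.lt_def] at h2 h3
        rw [Fin.le_def] at hlt
        omega

theorem sort_sortKey_lt (hf : Antitone f) (hfd : HasContent f d)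
    (hu : u ∈ flaggedWords f d s j) (i : Fin n)
    (hi : (u (Tuple.sort (sortKey u) i)).1 = true) : Tuple.sort (sortKey u) i < i := by
  induction hm : n - i.val using Nat.strong_induction_on generalizing i with
  | _ m ih =>
    have hfi := snd_sort_sortKey hf hfd hu i
    have hadm := Fintype.mem_piFinset.1 (Finset.mem_filter.1 hu).1 (Tuple.sort (sortKey u) i)
    simp only [flaggedLetters, Finset.mem_filter, hi, hfi, if_true] at hadm
    by_contra hlt
    rw [not_lt] at hlt
    rcases hadm.2 with h | ⟨h, w, hw, hfw⟩
    · exact (hf hlt).not_gt h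
    · have hw' := hlt.trans_lt hw
      have hpos : i.val + 1 < n := by rw [Fin.lt_def] at hw'; omega
      obtain ⟨i', hi'v⟩ : ∃ i' : Fin n, i'.val = i.val + 1 := ⟨⟨i.val + 1, hpos⟩, rfl⟩
      have hi' : i < i' := by rw [Fin.lt_def]; omega
      have hwi' : i' ≤ w := by rw [Fin.le_def]; rw [Fin.lt_def] at hw'; omega
      have hfi' : f i = f i' :=
        le_antisymm ((h.trans hfw.symm).le.trans (hf hwi')) (hf hi'.le)
      rcases sort_sortKey_lt_or hf hfd hu hi' hfi' with h1 | ⟨h1, h2⟩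
      · rw [hi] at h1; exact absurd h1 (by simp)
      · have h3 := ih (n - i'.val) (by rw [← hm]; omega) i' (h1.symm.trans hi) rfl
        rw [Fin.lt_def] at h2 h3
        rw [Fin.le_def] at hlt
        omega

theorem sort_sortKey_ne (hf : Antitone f) (hfd : HasContent f d)
    (hu : u ∈ flaggedWords f d s j) (i : Fin n) : Tuple.sort (sortKey u) i ≠ i := by
  cases h : (u (Tuple.sort (sortKey u) i)).1
  · exact (lt_sort_sortKey hf hfd hu i h).ne'
  · exact (sort_sortKey_lt hf hfd hu i h).ne

theorem flag_sort_sortKey (hf : Antitone f) (hfd : HasContent f d)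
    (hu : u ∈ flaggedWords f d s j) (i : Fin n) :
    (u (Tuple.sort (sortKey u) i)).1 = decide (Tuple.sort (sortKey u) i < i) := by
  cases h : (u (Tuple.sort (sortKey u) i)).1
  · simpa using (lt_sort_sortKey hf hfd hu i h).le
  · simpa using sort_sortKey_lt hf hfd hu i h

theorem flaggedWordOf_sort_sortKey (hf : Antitone f) (hfd : HasContent f d)
    (hu : u ∈ flaggedWords f d s j) : flaggedWordOf f (Tuple.sort (sortKey u)) = u := by
  funext v
  obtain ⟨i, rfl⟩ := (Tuple.sort (sortKey u)).surjective v
  simp only [flaggedWordOf, Equiv.symm_apply_apply]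
  exact Prod.ext (flag_sort_sortKey hf hfd hu i).symm (snd_sort_sortKey hf hfd hu i).symm

theorem isCompatible_sort_sortKey (hf : Antitone f) (hfd : HasContent f d)
    (hu : u ∈ flaggedWords f d s j) : IsCompatible (ExdSet (Tuple.sort (sortKey u))) f := by
  intro i hi
  have hlt : i < ⟨i.val + 1, hi⟩ := by rw [Fin.lt_def]; simp
  refine ⟨hf hlt.le, fun hmem => lt_of_le_of_ne (hf hlt.le) fun heq => ?_⟩
  have h := sort_sortKey_lt_or hf hfd hu hlt heq.symm
  rw [flag_sort_sortKey hf hfd hu, flag_sort_sortKey hf hfd hu] at h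
  rw [val_add_one_mem_ExdSet _ _ hi] at hmem
  have h1 := sort_sortKey_ne hf hfd hu i
  have h2 := sort_sortKey_ne hf hfd hu ⟨i.val + 1, hi⟩
  generalize (⟨i.val + 1, hi⟩ : Fin n) = i' at *
  generalize Tuple.sort (sortKey u) = σ at *
  by_cases ha : σ i < i <;> by_cases hb : σ i' < i' <;> simp [ha, hb] at h <;>
    first | exact absurd h (by decide) | grind

theorem card_compatible_derangements (hf : Antitone f) (hfd : HasContent f d)
    (hs : d.support ⊆ s) (j : ℕ) :
    (Finset.univ.filter fun σ : Equiv.Perm (Fin n) =>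
      ((∀ i, σ i ≠ i) ∧ exc σ = j) ∧ IsCompatible (ExdSet σ) f).card =
      (flaggedWords f d s j).card := by
  refine Finset.card_bij' (fun σ _ => flaggedWordOf f σ) (fun u _ => Tuple.sort (sortKey u))
    ?_ ?_ ?_ ?_
  · intro σ hσ
    simp only [Finset.mem_filter] at hσ
    exact hσ.2.1.2 ▸ flaggedWordOf_mem hf hfd hs hσ.2.1.1
  · intro u hu
    have hne := sort_sortKey_ne hf hfd hu
    refine Finset.mem_filter.2 ⟨Finset.mem_univ _, ⟨hne, ?_⟩, isCompatible_sort_sortKey hf hfd hu⟩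
    have h := flaggedWordOf_mem hf hfd hs hne
    rw [flaggedWordOf_sort_sortKey hf hfd hu] at h
    exact (Finset.mem_filter.1 h).2.2.symm.trans (Finset.mem_filter.1 hu).2.2
  · intro σ hσ
    simp only [Finset.mem_filter] at hσ
    exact (eq_sort_flaggedWordOf hσ.2.1.1 hσ.2.2).symm
  · intro u hu
    exact flaggedWordOf_sort_sortKey hf hfd hu

end FlaggedWord

/-- The product of the block weights of `d`, with letters from `s`. -/
noncomputable def blockProduct (s : Finset ℕ+) (d : ℕ+ →₀ ℕ) : MvPolynomial ℕ+ (Polynomial ℚ) :=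
  ∏ k ∈ s, blockWeight (MvPolynomial.C Polynomial.X)
    (offWeight (MvPolynomial.C Polynomial.X) MvPolynomial.X s k) (MvPolynomial.X k) (d k)

theorem coeff_Qtilde (d : ℕ+ →₀ ℕ) (n j : ℕ) (s : Finset ℕ+) (hs : d.support ⊆ s) :
    MvPowerSeries.coeff d (Qtilde n j) =
      if (d.sum fun _ e => e) = n then (MvPolynomial.coeff d (blockProduct s d)).coeff j else 0 := by
  rw [Qtilde, map_sum]
  split_ifs with h
  · subst h
    obtain ⟨f, hf, hfd⟩ := exists_antitone_hasContent d
    rw [blockProduct, ← prod_sum_letterWeight f d hfd s hs, coeff_prod_sum_letterWeight,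
      ← card_compatible_derangements hf hfd hs, Finset.sum_filter, Finset.card_filter, Nat.cast_sum]
    refine Finset.sum_congr rfl fun σ _ => ?_
    rw [coeff_Fqs hf hfd]
    split_ifs <;> simp_all
  · refine Finset.sum_eq_zero fun σ _ => ?_
    change (Nat.card {g : Fin n → ℕ+ // IsCompatible (ExdSet σ) g ∧ HasContent g d} : ℚ) = 0
    have : IsEmpty {g : Fin n → ℕ+ // IsCompatible (ExdSet σ) g ∧ HasContent g d} := by
      refine ⟨fun g => h ?_⟩
      have hg := (hasContent_iff_sum_single _ _).1 g.2.2
      rw [← hg]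
      have := Finsupp.card_toMultiset (∑ v, Finsupp.single (g.1 v) 1)
      rw [map_sum] at this
      simp only [Finsupp.toMultiset_single, one_smul, Multiset.card_sum, Multiset.card_singleton,
        Finset.sum_const, Finset.card_univ, Fintype.card_fin, smul_eq_mul, mul_one] at this
      exact this.symm
    simp

theorem sum_sum_of_add_eq {ι : Type*} {d : ι →₀ ℕ} {q : (ι →₀ ℕ) × (ι →₀ ℕ)}
    (hq : q.1 + q.2 = d) :
    (q.1.sum fun _ e => e) + (q.2.sum fun _ e => e) = d.sum fun _ e => e := by
  rw [← hq]
  exact (Finsupp.sum_add_index' (fun _ => rfl) fun _ _ _ => rfl).symm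

theorem coeff_prod_blockWeight (c : Polynomial ℚ) (d : ℕ+ →₀ ℕ) :
    MvPolynomial.coeff d (∏ k ∈ d.support, ∑ p ∈ Finset.HasAntidiagonal.antidiagonal (d k),
      blockWeight (MvPolynomial.C Polynomial.X)
        (offWeight (MvPolynomial.C Polynomial.X) MvPolynomial.X d.support k)
        (MvPolynomial.X k) p.1 * (MvPolynomial.C c * MvPolynomial.X k) ^ p.2) =
      ∑ q ∈ Finset.HasAntidiagonal.antidiagonal d,
        MvPolynomial.coeff q.1 (blockProduct d.support q.1) * c ^ (q.2.sum fun _ e => e) := by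
  rw [prod_sum_antidiagonal d fun k a b => blockWeight (MvPolynomial.C Polynomial.X)
        (offWeight (MvPolynomial.C Polynomial.X) MvPolynomial.X d.support k)
        (MvPolynomial.X k) a * (MvPolynomial.C c * MvPolynomial.X k) ^ b, MvPolynomial.coeff_sum]
  refine Finset.sum_congr rfl fun q hq => ?_
  have hd := Finset.HasAntidiagonal.mem_antidiagonal.1 hq
  have hsub : q.2.support ⊆ d.support := by
    intro k hk
    rw [Finsupp.mem_support_iff] at hk ⊢
    rw [← hd, Finsupp.add_apply]
    omega
  have hmono : ∏ k ∈ d.support, (MvPolynomial.C c * MvPolynomial.X k) ^ q.2 k =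
      MvPolynomial.monomial q.2 (c ^ (q.2.sum fun _ e => e)) := by
    simp only [mul_pow, Finset.prod_mul_distrib]
    rw [MvPolynomial.monomial_eq, Finset.prod_pow_eq_pow_sum, ← map_pow,
      Finsupp.sum_of_support_subset _ hsub _ fun _ _ => rfl,
      Finsupp.prod_of_support_subset _ hsub _ fun _ _ => pow_zero _]
  rw [Finset.prod_mul_distrib, hmono, ← blockProduct]
  exact (congrArg (fun e => MvPolynomial.coeff e _) hd.symm).trans
    (MvPolynomial.coeff_mul_monomial _ _ _ _)

theorem sum_coeff_blockProduct_mul_X_pow {d : ℕ+ →₀ ℕ} (hd : d ≠ 0) :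
    ∑ q ∈ Finset.HasAntidiagonal.antidiagonal d,
        MvPolynomial.coeff q.1 (blockProduct d.support q.1) *
          Polynomial.X ^ (q.2.sum fun _ e => e) =
      Polynomial.X * ∑ q ∈ Finset.HasAntidiagonal.antidiagonal d,
        MvPolynomial.coeff q.1 (blockProduct d.support q.1) := by
  have hy : ∑ l ∈ d.support, (MvPolynomial.X l : MvPolynomial ℕ+ (Polynomial ℚ)) ≠ 0 := by
    obtain ⟨k, hk⟩ := Finsupp.support_nonempty_iff.2 hd
    intro h
    have := congrArg (MvPolynomial.coeff (Finsupp.single k 1)) h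
    rw [MvPolynomial.coeff_sum, Finset.sum_eq_single k] at this
    · simp at this
    · intro l _ hl
      rw [MvPolynomial.coeff_X, if_neg]
      exact fun h => hl ((Finsupp.single_left_inj one_ne_zero).1 h)
    · exact fun h => absurd hk h
  have h1 := coeff_prod_blockWeight 1 d
  simp only [map_one, one_mul, one_pow, mul_one] at h1
  rw [← h1, ← coeff_prod_blockWeight, prod_sum_blockWeight_eq _ _ d hy, MvPolynomial.coeff_C_mul]

theorem sum_antidiagonal_ite_mul_ite (P : Polynomial ℚ) (a b c : ℕ) (D : Fin 2 →₀ ℕ) :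
    ∑ p ∈ Finset.HasAntidiagonal.antidiagonal D, (if a = p.1 1 then P.coeff (p.1 0) else 0) *
        (if p.2 0 = c then if b = p.2 1 then 1 else 0 else 0) =
      if a + b = D 1 then (P * Polynomial.X ^ c).coeff (D 0) else 0 := by
  rw [Polynomial.coeff_mul_X_pow']
  split_ifs with h1 h2
  · rw [Finset.sum_eq_single (Finsupp.equivFunOnFinite.symm ![D 0 - c, a],
      Finsupp.equivFunOnFinite.symm ![c, b])]
    · simp
    · rintro ⟨p, q⟩ hpq hne
      have hD := Finset.HasAntidiagonal.mem_antidiagonal.1 hpq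
      have h3 := DFunLike.congr_fun hD 0
      have h4 := DFunLike.congr_fun hD 1
      simp only [Finsupp.add_apply] at h3 h4
      have : ¬ (a = p 1 ∧ q 0 = c ∧ b = q 1) := by
        rintro ⟨h5, h6, h7⟩
        refine hne (Prod.ext (Finsupp.ext fun i => ?_) (Finsupp.ext fun i => ?_)) <;>
          fin_cases i <;> simp <;> omega
      simp only [mul_ite, mul_one, mul_zero]
      split_ifs <;> simp_all
    · intro h
      refine absurd (Finset.HasAntidiagonal.mem_antidiagonal.2 (Finsupp.ext fun i => ?_)) h
      fin_cases i <;> simp <;> omega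
  all_goals
    refine Finset.sum_eq_zero fun p hp => ?_
    have hD := Finset.HasAntidiagonal.mem_antidiagonal.1 hp
    have h3 := DFunLike.congr_fun hD 0
    have h4 := DFunLike.congr_fun hD 1
    simp only [Finsupp.add_apply] at h3 h4
    split_ifs <;> first | simp; done | omega

theorem coeff_coeff_genQtilde_mul (φ : MvPowerSeries (Fin 2) R) (c : ℕ → ℕ)
    (hφ : ∀ D d, MvPowerSeries.coeff d (MvPowerSeries.coeff D φ) =
      if D 0 = c (d.sum fun _ e => e) then if (d.sum fun _ e => e) = D 1 then 1 else 0 else 0)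
    (D : Fin 2 →₀ ℕ) (d : ℕ+ →₀ ℕ) :
    MvPowerSeries.coeff d (MvPowerSeries.coeff D (genQtilde * φ)) =
      if (d.sum fun _ e => e) = D 1 then
        (∑ q ∈ Finset.HasAntidiagonal.antidiagonal d,
          MvPolynomial.coeff q.1 (blockProduct d.support q.1) *
            Polynomial.X ^ c (q.2.sum fun _ e => e)).coeff (D 0)
      else 0 := by
  rw [MvPowerSeries.coeff_mul, map_sum]
  simp only [MvPowerSeries.coeff_mul, hφ]
  rw [Finset.sum_comm]
  have key : ∀ q ∈ Finset.HasAntidiagonal.antidiagonal d, ∀ p : (Fin 2 →₀ ℕ) × (Fin 2 →₀ ℕ),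
      MvPowerSeries.coeff q.1 (MvPowerSeries.coeff p.1 genQtilde) =
        if (q.1.sum fun _ e => e) = p.1 1 then
          (MvPolynomial.coeff q.1 (blockProduct d.support q.1)).coeff (p.1 0) else 0 := by
    intro q hq p
    refine coeff_Qtilde q.1 (p.1 1) (p.1 0) d.support fun k hk => ?_
    rw [Finsupp.mem_support_iff] at hk ⊢
    rw [← Finset.HasAntidiagonal.mem_antidiagonal.1 hq, Finsupp.add_apply]
    omega
  have key' : ∀ q ∈ Finset.HasAntidiagonal.antidiagonal d,
      ∑ p ∈ Finset.HasAntidiagonal.antidiagonal D,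
        MvPowerSeries.coeff q.1 (MvPowerSeries.coeff p.1 genQtilde) *
          (if p.2 0 = c (q.2.sum fun _ e => e) then
            if (q.2.sum fun _ e => e) = p.2 1 then 1 else 0 else 0) =
      if (d.sum fun _ e => e) = D 1 then
        (MvPolynomial.coeff q.1 (blockProduct d.support q.1) *
          Polynomial.X ^ c (q.2.sum fun _ e => e)).coeff (D 0) else 0 := by
    intro q hq
    rw [← sum_sum_of_add_eq (Finset.HasAntidiagonal.mem_antidiagonal.1 hq)]
    refine Eq.trans ?_ (sum_antidiagonal_ite_mul_ite _ _ _ _ D)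
    refine Finset.sum_congr rfl fun p _ => ?_
    rw [key q hq p]
  rw [Finset.sum_congr rfl key']
  split_ifs
  · rw [Polynomial.finsetSum_coeff]
  · exact Finset.sum_const_zero

theorem coeff_coeff_genQtilde_mul_Hzt (D : Fin 2 →₀ ℕ) (d : ℕ+ →₀ ℕ) :
    MvPowerSeries.coeff d (MvPowerSeries.coeff D (genQtilde * Hzt)) =
      if (d.sum fun _ e => e) = D 1 then
        (∑ q ∈ Finset.HasAntidiagonal.antidiagonal d,
          MvPolynomial.coeff q.1 (blockProduct d.support q.1) *
            Polynomial.X ^ (q.2.sum fun _ e => e)).coeff (D 0)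
      else 0 := by
  refine coeff_coeff_genQtilde_mul Hzt id (fun D d => ?_) D d
  change (if D 0 = D 1 then hSym (D 1) else 0 : R) d = _
  by_cases h : D 0 = D 1
  · rw [if_pos h, hSym, id, h]
    split_ifs with h1 h2 h2
    · rfl
    · exact absurd h1.symm h2
    · rfl
    · rfl
  · rw [if_neg h, id]
    change (0 : ℚ) = _
    split_ifs with h1 h2
    · exact absurd (h1.trans h2) h
    · rfl
    · rfl

theorem coeff_coeff_genQtilde_mul_Hz (D : Fin 2 →₀ ℕ) (d : ℕ+ →₀ ℕ) :
    MvPowerSeries.coeff d (MvPowerSeries.coeff D (genQtilde * Hz)) =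
      if (d.sum fun _ e => e) = D 1 then
        (∑ q ∈ Finset.HasAntidiagonal.antidiagonal d,
          MvPolynomial.coeff q.1 (blockProduct d.support q.1)).coeff (D 0)
      else 0 := by
  have h := coeff_coeff_genQtilde_mul Hz (fun _ => 0) (fun D d => ?_) D d
  · simpa only [pow_zero, mul_one] using h
  · change (if D 0 = 0 then hSym (D 1) else 0 : R) d = _
    by_cases h : D 0 = 0
    · rw [if_pos h, if_pos h, hSym]
    · rw [if_neg h, if_neg h]; rfl

theorem coeff_coeff_T_mul (φ : MvPowerSeries (Fin 2) R) (P : (ℕ+ →₀ ℕ) → Polynomial ℚ)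
    (hφ : ∀ D d, MvPowerSeries.coeff d (MvPowerSeries.coeff D φ) =
      if (d.sum fun _ e => e) = D 1 then (P d).coeff (D 0) else 0)
    (D : Fin 2 →₀ ℕ) (d : ℕ+ →₀ ℕ) :
    MvPowerSeries.coeff d (MvPowerSeries.coeff D (T * φ)) =
      if (d.sum fun _ e => e) = D 1 then (Polynomial.X * P d).coeff (D 0) else 0 := by
  rw [T, MvPowerSeries.X, MvPowerSeries.coeff_monomial_mul, one_mul, mul_comm,
    ← pow_one Polynomial.X, Polynomial.coeff_mul_X_pow']
  have hle : Finsupp.single (0 : Fin 2) 1 ≤ D ↔ 1 ≤ D 0 := Finsupp.single_le_iff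
  by_cases h : 1 ≤ D 0
  · rw [if_pos (hle.2 h), hφ]
    simp [h]
  · rw [if_neg (fun h' => h (hle.1 h'))]
    simp [h]

theorem coeff_coeff_one_sub_T (D : Fin 2 →₀ ℕ) (d : ℕ+ →₀ ℕ) :
    MvPowerSeries.coeff d (MvPowerSeries.coeff D (1 - T)) =
      if (d.sum fun _ e => e) = D 1 then
        (if d = 0 then 1 - Polynomial.X else 0 : Polynomial ℚ).coeff (D 0) else 0 := by
  have h1 : ∀ (D : Fin 2 →₀ ℕ) (d : ℕ+ →₀ ℕ),
      MvPowerSeries.coeff d (MvPowerSeries.coeff D (1 : MvPowerSeries (Fin 2) R)) =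
        if (d.sum fun _ e => e) = D 1 then
          (if d = 0 then 1 else 0 : Polynomial ℚ).coeff (D 0) else 0 := by
    intro D d
    have hD : D = 0 ↔ D 0 = 0 ∧ D 1 = 0 := by
      simp [Finsupp.ext_iff, Fin.forall_fin_two]
    rw [MvPowerSeries.coeff_one]
    by_cases hd : d = 0
    · subst hd
      by_cases h0 : D 0 = 0 <;> by_cases h1 : 0 = D 1 <;>
        simp [hD, h0, eq_comm (a := D 1), Polynomial.coeff_one, h1]
    · split_ifs <;> simp [MvPowerSeries.coeff_one, hd]
  have h2 := coeff_coeff_T_mul 1 _ h1 D d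
  rw [mul_one] at h2
  rw [map_sub, map_sub, h1, h2]
  split_ifs <;> simp

theorem Qtilde_generating_function :
    genQtilde * (Hzt - T * Hz) = 1 - T := by
  refine MvPowerSeries.ext fun D => MvPowerSeries.ext fun d => ?_
  rw [coeff_coeff_one_sub_T, mul_sub, mul_left_comm, map_sub, map_sub,
    coeff_coeff_genQtilde_mul_Hzt, coeff_coeff_T_mul _ _ coeff_coeff_genQtilde_mul_Hz]
  by_cases hd : d = 0
  · subst hd
    rw [if_pos rfl]
    split_ifs <;> simp [blockProduct]
  · rw [sum_coeff_blockProduct_mul_X_pow hd, sub_self]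
    simp [hd]
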